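/- Let n ≥ 1 and let w : Fin n → Fin n → EReal be edge lengths with no negative cycles, and let d₁ = F(w) be the matrix after one run of the IJK algorithm starting from d = w. Then for every pair of vertices s, t with dist_w(s,t) < +∞, there exists a finite sequence of vertices s = v₀, v₁, …, v_{l'} = t that is upper unimodal as a sequence in Fin n (there is an index h with v₀ < v₁ < ⋯ < v_h and v_h > v_{h+1} > ⋯ > v_{l'}) such that the sum of d₁[v_p, v_{p+1}] over p equals dist_w(s,t). -/

import Mathlib

open scoped BigOperators

noncomputable section

/-- The total `d`-length of a walk, given as the list of visited vertices.
A walk visiting at most one vertex has length `0`. -/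
def walkLen {n : ℕ} (d : Fin n → Fin n → EReal) : List (Fin n) → EReal
  | [] => 0
  | [_] => 0
  | a :: b :: rest => d a b + walkLen d (b :: rest)

/-- Shortest-path distance from `s` to `t`: the infimum of walk lengths over all
finite walks from `s` to `t` (the empty walk `[s]` from `s` to `s` has length `0`). -/
def distW {n : ℕ} (d : Fin n → Fin n → EReal) (s t : Fin n) : EReal :=
  sInf {c : EReal | ∃ u : List (Fin n),
    u.head? = some s ∧ u.getLast? = some t ∧ walkLen d u = c}

/-- No negative cycles: every closed walk has nonnegative total length. -/
def NoNegCycle {n : ℕ} (w : Fin n → Fin n → EReal) : Prop :=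
  ∀ (u : List (Fin n)) (v : Fin n),
    u.head? = some v → u.getLast? = some v → 0 ≤ walkLen w u

/-- The relaxation update `d[i,j] ← min (d[i,j]) (d[i,k] + d[k,j])`,
leaving all other entries unchanged. -/
def upd {n : ℕ} (d : Fin n → Fin n → EReal) (i j k : Fin n) :
    Fin n → Fin n → EReal :=
  fun x y => if x = i ∧ y = j then min (d i j) (d i k + d k j) else d x y

/-- All triples of `Fin n` in lexicographic order. -/
def triplesLex (n : ℕ) : List (Fin n × Fin n × Fin n) :=
  (List.finRange n).flatMap fun a =>
    (List.finRange n).flatMap fun b =>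
      (List.finRange n).map fun c => (a, b, c)

/-- One run of the IJK algorithm: the triples `(i, j, k)` are processed in
lexicographic order of `(i, j, k)`, updating `d[i,j] ← min (d[i,j]) (d[i,k] + d[k,j])`. -/
def runIJK {n : ℕ} (d : Fin n → Fin n → EReal) : Fin n → Fin n → EReal :=
  (triplesLex n).foldl (fun d t => upd d t.1 t.2.1 t.2.2) d

/-- One run of the IKJ algorithm: the triples `(i, k, j)` are processed in
lexicographic order of `(i, k, j)`, updating `d[i,j] ← min (d[i,j]) (d[i,k] + d[k,j])`. -/
def runIKJ {n : ℕ} (d : Fin n → Fin n → EReal) : Fin n → Fin n → EReal :=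
  (triplesLex n).foldl (fun d t => upd d t.1 t.2.2 t.2.1) d

/-- One run of the (correct) KIJ Floyd–Warshall algorithm: the triples `(k, i, j)` are
processed in lexicographic order of `(k, i, j)`,
updating `d[i,j] ← min (d[i,j]) (d[i,k] + d[k,j])`. -/
def runKIJ {n : ℕ} (d : Fin n → Fin n → EReal) : Fin n → Fin n → EReal :=
  (triplesLex n).foldl (fun d t => upd d t.2.1 t.2.2 t.1) d

/-- The partial run of the IJK algorithm consisting of all update triples `(i, j, k)`
with `i ≤ m`, in lexicographic order. -/
def runIJKUpto {n : ℕ} (m : Fin n) (d : Fin n → Fin n → EReal) :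
    Fin n → Fin n → EReal :=
  ((triplesLex n).filter (fun t => decide (t.1 ≤ m))).foldl
    (fun d t => upd d t.1 t.2.1 t.2.2) d

/-- The partial run of the IKJ algorithm consisting of all update triples `(i, k, j)`
with `i ≤ m`, in lexicographic order. -/
def runIKJUpto {n : ℕ} (m : Fin n) (d : Fin n → Fin n → EReal) :
    Fin n → Fin n → EReal :=
  ((triplesLex n).filter (fun t => decide (t.1 ≤ m))).foldl
    (fun d t => upd d t.1 t.2.2 t.2.1) d

/-- The `d`-length of the portion `u_a, u_{a+1}, …, u_c` of the vertex sequence `u`. -/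
def pathLen {n : ℕ} (d : Fin n → Fin n → EReal) (u : ℕ → Fin n) (a c : ℕ) : EReal :=
  ∑ p ∈ Finset.Ico a c, d (u p) (u (p + 1))

/-- `u_0, …, u_l` is a shortest path w.r.t. `w`: every sub-walk `u_a, …, u_c`
has `w`-length equal to the shortest-path distance from `u_a` to `u_c`. -/
def IsShortestPath {n : ℕ} (w : Fin n → Fin n → EReal) (u : ℕ → Fin n) (l : ℕ) : Prop :=
  ∀ a c, a ≤ c → c ≤ l → pathLen w u a c = distW w (u a) (u c)

theorem upd_le {n : ℕ} (d : Fin n → Fin n → EReal) (i j k x y : Fin n) :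
    upd d i j k x y ≤ d x y := by
  unfold upd
  split_ifs with h
  · obtain ⟨rfl, rfl⟩ := h
    exact min_le_left _ _
  · exact le_rfl

theorem foldl_upd_le {n : ℕ} (L : List (Fin n × Fin n × Fin n)) (d : Fin n → Fin n → EReal)
    (x y : Fin n) : L.foldl (fun d t => upd d t.1 t.2.1 t.2.2) d x y ≤ d x y := by
  induction L generalizing d with
  | nil => exact le_rfl
  | cons t L ih => exact (ih _).trans (upd_le _ _ _ _ _ _)

/-- Entries that are not the target of any update are left unchanged. -/
theorem foldl_upd_eq {n : ℕ} (L : List (Fin n × Fin n × Fin n)) (d : Fin n → Fin n → EReal)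
    (x y : Fin n) (h : ∀ t ∈ L, ¬(x = t.1 ∧ y = t.2.1)) :
    L.foldl (fun d t => upd d t.1 t.2.1 t.2.2) d x y = d x y := by
  induction L generalizing d with
  | nil => rfl
  | cons t L ih =>
    rw [List.foldl_cons, ih _ fun r hr => h r (List.mem_cons_of_mem _ hr), upd,
      if_neg (h t List.mem_cons_self)]

theorem pairwise_triplesLex (n : ℕ) :
    (triplesLex n).Pairwise fun x y => x.1 < y.1 ∨ x.1 = y.1 ∧ x.2.1 ≤ y.2.1 := by
  unfold triplesLex
  rw [List.pairwise_flatMap]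
  refine ⟨fun a _ => ?_, (List.pairwise_lt_finRange n).imp fun {a b} hab x hx y hy => ?_⟩
  · rw [List.pairwise_flatMap]
    refine ⟨fun b _ => ?_, (List.pairwise_lt_finRange n).imp fun {b c} hbc x hx y hy => ?_⟩
    · rw [List.pairwise_map]
      exact List.pairwise_of_forall fun _ _ => Or.inr ⟨rfl, le_rfl⟩
    · simp only [List.mem_map] at hx hy
      obtain ⟨_, _, rfl⟩ := hx
      obtain ⟨_, _, rfl⟩ := hy
      exact Or.inr ⟨rfl, hbc.le⟩
  · simp only [List.mem_flatMap, List.mem_map] at hx hy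
    obtain ⟨_, _, _, _, rfl⟩ := hx
    obtain ⟨_, _, _, _, rfl⟩ := hy
    exact Or.inl hab

theorem mem_triplesLex {n : ℕ} (x : Fin n × Fin n × Fin n) : x ∈ triplesLex n := by
  simp [triplesLex]

/-- The triangle inequality through a vertex smaller than both endpoints holds after one run. -/
theorem runIJK_le_add {n : ℕ} (w : Fin n → Fin n → EReal) {a b m : Fin n}
    (ha : m < a) (hb : m < b) : runIJK w a b ≤ runIJK w a m + runIJK w m b := by
  obtain ⟨L₁, L₂, hL⟩ := List.append_of_mem (mem_triplesLex (a, b, m))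
  have hlater : ∀ t ∈ L₂, a < t.1 ∨ a = t.1 ∧ b ≤ t.2.1 := by
    have hp := pairwise_triplesLex n
    rw [hL, List.pairwise_append, List.pairwise_cons] at hp
    exact hp.2.1.1
  have hrun := congrArg (List.foldl (fun d t => upd d t.1 t.2.1 t.2.2) w) hL
  rw [List.foldl_append, List.foldl_cons] at hrun
  change runIJK w = _ at hrun
  set d := L₁.foldl (fun d t => upd d t.1 t.2.1 t.2.2) w
  have ham : runIJK w a m = d a m := by
    rw [hrun, foldl_upd_eq, upd, if_neg fun h => hb.ne h.2]
    rintro t ht ⟨h₁, h₂⟩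
    rcases hlater t ht with h | h
    · exact h.ne h₁
    · exact (hb.trans_le h.2).ne h₂
  have hmb : runIJK w m b = d m b := by
    rw [hrun, foldl_upd_eq, upd, if_neg fun h => ha.ne h.1]
    rintro t ht ⟨h₁, -⟩
    rcases hlater t ht with h | h
    · exact (ha.trans h).ne h₁
    · exact ha.ne (h₁.trans h.1.symm)
  rw [ham, hmb, hrun]
  refine (foldl_upd_le _ _ _ _).trans ?_
  simp [upd]

theorem walkLen_mono {n : ℕ} {d e : Fin n → Fin n → EReal} (h : ∀ x y, d x y ≤ e x y) :
    ∀ u : List (Fin n), walkLen d u ≤ walkLen e u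
  | [] => le_rfl
  | [_] => le_rfl
  | a :: b :: u => add_le_add (h a b) (walkLen_mono h (b :: u))

theorem exists_walk_trans {n : ℕ} (d : Fin n → Fin n → EReal) {b c : Fin n} (v : List (Fin n))
    (hv : v.head? = some b) (hv' : v.getLast? = some c) :
    ∀ (u : List (Fin n)) (a : Fin n), u.head? = some a → u.getLast? = some b →
      ∃ r : List (Fin n), r.head? = some a ∧ r.getLast? = some c ∧
        walkLen d r = walkLen d u + walkLen d v
  | [], a, h, _ => by simp at h
  | [x], a, h, h' => by
    simp only [List.head?_cons, Option.some.injEq, List.getLast?_singleton] at h h'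
    subst h h'
    exact ⟨v, hv, hv', by simp [walkLen]⟩
  | x :: y :: u, a, h, h' => by
    obtain ⟨r, hr, hr', hlen⟩ := exists_walk_trans d v hv hv' (y :: u) y rfl
      (by rwa [List.getLast?_cons_cons] at h')
    obtain ⟨r, rfl⟩ : ∃ q, r = y :: q := List.head?_eq_some_iff.1 hr
    exact ⟨x :: y :: r, h, by rwa [List.getLast?_cons_cons],
      by rw [walkLen, hlen, walkLen, add_assoc]⟩

/-- Every entry of `d` is the `w`-length of some walk with the same endpoints. -/
def EntriesAreWalks {n : ℕ} (w d : Fin n → Fin n → EReal) : Prop :=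
  ∀ x y, ∃ u : List (Fin n), u.head? = some x ∧ u.getLast? = some y ∧ walkLen w u = d x y

theorem EntriesAreWalks.self {n : ℕ} (w : Fin n → Fin n → EReal) : EntriesAreWalks w w :=
  fun x y => ⟨[x, y], rfl, rfl, by simp [walkLen]⟩

theorem EntriesAreWalks.upd {n : ℕ} {w d : Fin n → Fin n → EReal} (h : EntriesAreWalks w d)
    (i j k : Fin n) : EntriesAreWalks w (upd d i j k) := by
  intro x y
  unfold _root_.upd
  split_ifs with hxy
  · obtain ⟨rfl, rfl⟩ := hxy
    rcases min_choice (d x y) (d x k + d k y) with hm | hm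
    · rw [hm]
      exact h x y
    · obtain ⟨u, hu, hu', hul⟩ := h x k
      obtain ⟨v, hv, hv', hvl⟩ := h k y
      rw [hm, ← hul, ← hvl]
      exact exists_walk_trans w v hv hv' u x hu hu'
  · exact h x y

theorem EntriesAreWalks.runIJK {n : ℕ} (w : Fin n → Fin n → EReal) :
    EntriesAreWalks w (runIJK w) := by
  have key : ∀ (L : List (Fin n × Fin n × Fin n)) (d : Fin n → Fin n → EReal),
      EntriesAreWalks w d →
        EntriesAreWalks w (L.foldl (fun d t => _root_.upd d t.1 t.2.1 t.2.2) d) := by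
    intro L
    induction L with
    | nil => exact fun _ h => h
    | cons t L ih => exact fun d h => ih _ (h.upd _ _ _)
  exact key _ _ (EntriesAreWalks.self w)

theorem EntriesAreWalks.exists_walk {n : ℕ} {w d : Fin n → Fin n → EReal}
    (h : EntriesAreWalks w d) {t : Fin n} :
    ∀ (u : List (Fin n)) (s : Fin n), u.head? = some s → u.getLast? = some t →
      ∃ r : List (Fin n), r.head? = some s ∧ r.getLast? = some t ∧ walkLen w r = walkLen d u
  | [], s, hs, _ => by simp at hs
  | [x], s, hs, ht => ⟨[x], hs, ht, rfl⟩
  | x :: y :: u, s, hs, ht => by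
    obtain ⟨r, hr, hr', hlen⟩ := h.exists_walk (y :: u) y rfl
      (by rwa [List.getLast?_cons_cons] at ht)
    obtain ⟨q, hq, hq', hql⟩ := h x y
    obtain rfl : x = s := Option.some.inj hs
    rw [walkLen, ← hlen, ← hql]
    exact exists_walk_trans w r hr hr' q x hq hq'

/-- Lists that strictly increase and then strictly decrease. -/
inductive UpperUnimodal {n : ℕ} : List (Fin n) → Prop
  | desc {l : List (Fin n)} : l.IsChain (· > ·) → UpperUnimodal l
  | up {a b : Fin n} {l : List (Fin n)} :
      a < b → UpperUnimodal (b :: l) → UpperUnimodal (a :: b :: l)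

theorem length_le_of_isChain_gt {n : ℕ} :
    ∀ (l : List (Fin n)) (a : Fin n), (a :: l).IsChain (· > ·) → (a :: l).length ≤ a + 1
  | [], a, _ => by simp
  | b :: l, a, h => by
    rw [List.isChain_cons_cons] at h
    have := length_le_of_isChain_gt l b h.2
    have := h.1
    simp only [List.length_cons, gt_iff_lt, Fin.lt_def] at *
    omega

theorem UpperUnimodal.length_le {n : ℕ} {l : List (Fin n)} (h : UpperUnimodal l) :
    l.length ≤ 2 * n := by
  suffices H : ∀ a ∈ l.head?, l.length + a ≤ 2 * n by
    cases l with
    | nil => simp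
    | cons a l => exact (Nat.le_add_right _ _).trans (H a rfl)
  induction h with
  | @desc l h =>
    cases l with
    | nil => simp
    | cons b l =>
      rintro a ha
      obtain rfl : b = a := Option.some.inj ha
      have := length_le_of_isChain_gt l b h
      omega
  | @up b c l hbc _ ih =>
    rintro a ha
    obtain rfl : b = a := Option.some.inj ha
    have := ih c rfl
    simp only [List.length_cons, Fin.lt_def] at *
    omega

/-- Prepending a vertex to an upper unimodal walk and removing all valleys. -/
theorem exists_upperUnimodal_cons {n : ℕ} {d : Fin n → Fin n → EReal}
    (hd : ∀ x, 0 ≤ d x x) (htri : ∀ a b m, m < a → m < b → d a b ≤ d a m + d m b)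
    (a : Fin n) : ∀ (l : List (Fin n)) (b : Fin n), UpperUnimodal (b :: l) →
      ∃ v : List (Fin n), UpperUnimodal v ∧ v.head? = some a ∧
        v.getLast? = (b :: l).getLast? ∧ walkLen d v ≤ walkLen d (a :: b :: l) := by
  intro l
  induction l with
  | nil =>
    intro b hb
    rcases lt_trichotomy a b with hab | rfl | hab
    · exact ⟨[a, b], .up hab hb, rfl, rfl, le_rfl⟩
    · exact ⟨[a], hb, rfl, rfl, by simpa [walkLen] using hd a⟩
    · exact ⟨[a, b], .desc (by simpa using hab), rfl, rfl, le_rfl⟩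
  | cons c l ih =>
    intro b hb
    rcases lt_trichotomy a b with hab | rfl | hab
    · exact ⟨a :: b :: c :: l, .up hab hb, rfl, List.getLast?_cons_cons, le_rfl⟩
    · refine ⟨a :: c :: l, hb, rfl, rfl, ?_⟩
      rw [walkLen.eq_3 d a a]
      exact le_add_of_nonneg_left (hd a)
    · cases hb with
      | desc h =>
        exact ⟨a :: b :: c :: l, .desc (List.isChain_cons_cons.2 ⟨hab, h⟩), rfl,
          List.getLast?_cons_cons, le_rfl⟩
      | up hbc h =>
        obtain ⟨v, hv, hva, hvl, hlen⟩ := ih c h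
        refine ⟨v, hv, hva, by rw [hvl, List.getLast?_cons_cons], hlen.trans ?_⟩
        rw [walkLen, walkLen, walkLen, ← add_assoc]
        exact add_le_add_left (htri a c b hab hbc) _

theorem exists_upperUnimodal_le {n : ℕ} {d : Fin n → Fin n → EReal}
    (hd : ∀ x, 0 ≤ d x x) (htri : ∀ a b m, m < a → m < b → d a b ≤ d a m + d m b) :
    ∀ u : List (Fin n), ∃ v : List (Fin n), UpperUnimodal v ∧ v.head? = u.head? ∧
      v.getLast? = u.getLast? ∧ walkLen d v ≤ walkLen d u
  | [] => ⟨[], .desc .nil, rfl, rfl, le_rfl⟩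
  | [x] => ⟨[x], .desc (.singleton x), rfl, rfl, le_rfl⟩
  | a :: b :: u => by
    obtain ⟨v, hv, hvb, hvl, hlen⟩ := exists_upperUnimodal_le hd htri (b :: u)
    obtain ⟨v, rfl⟩ : ∃ q, v = b :: q := List.head?_eq_some_iff.1 hvb
    obtain ⟨r, hr, hra, hrl, hrlen⟩ := exists_upperUnimodal_cons hd htri a v b hv
    refine ⟨r, hr, hra, by rw [hrl, hvl, List.getLast?_cons_cons], hrlen.trans ?_⟩
    rw [walkLen, walkLen]
    exact add_le_add_right hlen _

theorem pathLen_getD {n : ℕ} (d : Fin n → Fin n → EReal) (t : Fin n) :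
    ∀ l : List (Fin n), pathLen d (fun p => l.getD p t) 0 (l.length - 1) = walkLen d l
  | [] => by simp [pathLen, walkLen]
  | [_] => by simp [pathLen, walkLen]
  | a :: b :: l => by
    have ih := pathLen_getD d t (b :: l)
    simp only [pathLen, ← Finset.range_eq_Ico, List.length_cons, Nat.add_sub_cancel] at ih ⊢
    rw [Finset.sum_range_succ', walkLen, ← ih, add_comm]
    rfl

theorem getD_lt_getD_of_isChain_gt {n : ℕ} (t : Fin n) :
    ∀ l : List (Fin n), l.IsChain (· > ·) → ∀ p, p + 1 < l.length →
      l.getD (p + 1) t < l.getD p t := by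
  intro l h p hp
  rw [List.getD_eq_getElem _ _ hp, List.getD_eq_getElem _ _ (by omega)]
  exact List.isChain_iff_getElem.1 h p hp

theorem UpperUnimodal.exists_peak {n : ℕ} (t : Fin n) {l : List (Fin n)}
    (hl : UpperUnimodal l) : ∃ h ≤ l.length - 1,
      (∀ p, p < h → l.getD p t < l.getD (p + 1) t) ∧
      ∀ p, h ≤ p → p < l.length - 1 → l.getD (p + 1) t < l.getD p t := by
  induction hl with
  | @desc l hl =>
    exact ⟨0, Nat.zero_le _, by simp,
      fun p _ hp => getD_lt_getD_of_isChain_gt t l hl p (by omega)⟩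
  | @up a b l hab _ ih =>
    obtain ⟨h, hh, hup, hdown⟩ := ih
    refine ⟨h + 1, by simpa using hh, fun p hp => ?_, fun p hp hp' => ?_⟩
    · cases p with
      | zero => exact hab
      | succ p => exact hup p (by omega)
    · cases p with
      | zero => omega
      | succ p => exact hdown p (by omega) (by simpa using hp')

/-- After one run of the IJK algorithm, every finite shortest path
distance is realized by an upper unimodal vertex sequence measured in the new matrix. -/
theorem ijk_one_run_unimodal_path (n : ℕ) (hn : 1 ≤ n)
    (w : Fin n → Fin n → EReal) (hw : ∀ i j, w i j ≠ ⊥) (hncyc : NoNegCycle w)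
    (s t : Fin n) (hst : distW w s t < ⊤) :
    ∃ (v : ℕ → Fin n) (l' h : ℕ), h ≤ l' ∧ v 0 = s ∧ v l' = t ∧
      (∀ p, p < h → v p < v (p + 1)) ∧
      (∀ p, h ≤ p → p < l' → v (p + 1) < v p) ∧
      pathLen (runIJK w) v 0 l' = distW w s t := by
  have hwalk := EntriesAreWalks.runIJK w
  have hdiag : ∀ x, 0 ≤ runIJK w x x := by
    intro x
    obtain ⟨u, hu, hu', hlen⟩ := hwalk x x
    exact hlen ▸ hncyc u x hu hu'
  have hreduce := exists_upperUnimodal_le hdiag fun _ _ _ => runIJK_le_add w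
  let S : Set (List (Fin n)) := {l | UpperUnimodal l ∧ l.head? = some s ∧ l.getLast? = some t}
  have hfin : S.Finite := (List.finite_length_le (Fin n) (2 * n)).subset fun l hl => hl.1.length_le
  have hne : S.Nonempty := by
    obtain ⟨v, hv, hs, ht, -⟩ := hreduce [s, t]
    exact ⟨v, hv, hs, ht⟩
  obtain ⟨l, ⟨hl, hs, ht⟩, hmin⟩ := Set.exists_min_image S (walkLen (runIJK w)) hfin hne
  have hlen : walkLen (runIJK w) l = distW w s t := by
    apply le_antisymm
    · refine le_sInf ?_
      rintro _ ⟨u, hus, hut, rfl⟩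
      obtain ⟨v, hv, hvs, hvt, hle⟩ := hreduce u
      exact (hmin v ⟨hv, hvs.trans hus, hvt.trans hut⟩).trans
        (hle.trans (walkLen_mono (foldl_upd_le _ _) u))
    · exact sInf_le (hwalk.exists_walk l s hs ht)
  obtain ⟨h, hh, hup, hdown⟩ := hl.exists_peak t
  refine ⟨fun p => l.getD p t, l.length - 1, h, hh, ?_, ?_, hup, hdown,
    (pathLen_getD _ t l).trans hlen⟩
  · simp [List.getD_eq_getElem?_getD, ← List.head?_eq_getElem?, hs]
  · simp [List.getD_eq_getElem?_getD, ← List.getLast?_eq_getElem?, ht]
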